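/- arXiv:2108.01270 — 4 statements merged into one kernel-verified Lean document; each statement's English description precedes it below -/
import Mathlib

section
/- For every complex number s with Re(s) ≤ 1, the Dirichlet series ∑_{n=1}^∞ 1/n^s diverges; that is, the sequence of partial sums N ↦ ∑_{n=1}^N n^{-s} does not converge in ℂ. In particular the Dirichlet series diverges throughout the critical strip 0 < Re(s) < 1. -/
open Complex Real Filter Topology

/-- Over a short multiplicative block the phases of the terms `n ^ (-s)` stay within one radian
of the phase at the left endpoint `N`. -/
lemma cos_one_div_le_re_phase_mul_one_div_cpow {s : ℂ} (hs : s.re ≤ 1) {N n : ℕ} (hN : 0 < N)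
    (hNn : N ≤ n) (h : |s.im| * (Real.log n - Real.log N) ≤ 1) :
    Real.cos 1 / n ≤ (Complex.exp ((s.im * Real.log N : ℝ) * I) * (1 / (n : ℂ) ^ s)).re := by
  have hn : 0 < n := hN.trans_le hNn
  have hn' : (0 : ℝ) < n := by exact_mod_cast hn
  have hlog : Real.log N ≤ Real.log n :=
    Real.log_le_log (by exact_mod_cast hN) (by exact_mod_cast hNn)
  have hterm : Complex.exp ((s.im * Real.log N : ℝ) * I) * (1 / (n : ℂ) ^ s) =
      Complex.exp ((s.im * Real.log N : ℝ) * I - Real.log n * s) := by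
    rw [Complex.cpow_def_of_ne_zero (by exact_mod_cast hn.ne'), Complex.exp_sub,
      Complex.natCast_log, mul_one_div]
  have hcos : Real.cos 1 ≤ Real.cos (s.im * Real.log N - Real.log n * s.im) := by
    rw [← Real.cos_abs (s.im * Real.log N - Real.log n * s.im)]
    apply Real.cos_le_cos_of_nonneg_of_le_pi (abs_nonneg _) (by linarith [Real.pi_gt_three])
    rw [show s.im * Real.log N - Real.log n * s.im = -(s.im * (Real.log n - Real.log N)) by ring,
      abs_neg, abs_mul, abs_of_nonneg (sub_nonneg.2 hlog)]
    exact h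
  have hexp : (n : ℝ)⁻¹ ≤ Real.exp (-(Real.log n * s.re)) := by
    rw [← Real.exp_log (inv_pos.2 hn'), Real.log_inv]
    exact Real.exp_le_exp.2 (by nlinarith [Real.log_natCast_nonneg n])
  rw [hterm, Complex.exp_re]
  simp only [Complex.sub_re, Complex.sub_im, Complex.re_ofReal_mul, Complex.im_ofReal_mul,
    Complex.I_re, Complex.I_im, mul_zero, mul_one, zero_sub]
  rw [div_eq_inv_mul]
  exact mul_le_mul hexp hcos Real.cos_one_pos.le (Real.exp_pos _).le

/-- The block of terms with `K * m < n ≤ (K + 1) * m` is bounded away from zero uniformly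
in `m`, once `K ≥ |Im s|`. -/
lemma cos_one_div_le_norm_sum_Ioc_one_div_cpow {s : ℂ} (hs : s.re ≤ 1) {K m : ℕ} (hK : 0 < K)
    (hKs : |s.im| ≤ K) (hm : 0 < m) :
    Real.cos 1 / (K + 1) ≤ ‖∑ n ∈ Finset.Ioc (K * m) ((K + 1) * m), 1 / (n : ℂ) ^ s‖ := by
  have hK' : (0 : ℝ) < K := by exact_mod_cast hK
  have hm' : (0 : ℝ) < m := by exact_mod_cast hm
  have hterm : ∀ n ∈ Finset.Ioc (K * m) ((K + 1) * m), Real.cos 1 / ((K + 1) * m) ≤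
      (Complex.exp ((s.im * Real.log (K * m : ℕ) : ℝ) * I) * (1 / (n : ℂ) ^ s)).re := by
    intro n hn
    obtain ⟨h1, h2⟩ := Finset.mem_Ioc.1 hn
    have hn0 : (0 : ℝ) < n := by exact_mod_cast (Nat.zero_le _).trans_lt h1
    have h2' : (n : ℝ) ≤ (K + 1) * m := by exact_mod_cast h2
    have hlog : Real.log n - Real.log (K * m : ℕ) ≤ 1 / K := by
      rw [← Real.log_div hn0.ne' (by positivity)]
      refine (Real.log_le_sub_one_of_pos (by positivity)).trans ?_
      rw [sub_le_iff_le_add, div_le_iff₀ (by positivity)]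
      refine h2'.trans_eq ?_
      push_cast
      field_simp
      ring
    refine le_trans ?_ (cos_one_div_le_re_phase_mul_one_div_cpow hs (by positivity) h1.le ?_)
    · exact div_le_div_of_nonneg_left Real.cos_one_pos.le hn0 h2'
    · calc |s.im| * (Real.log n - Real.log (K * m : ℕ)) ≤ |s.im| * (1 / K) := by gcongr
        _ ≤ K * (1 / K) := by gcongr
        _ = 1 := by field_simp
  calc Real.cos 1 / (K + 1)
      = ∑ _n ∈ Finset.Ioc (K * m) ((K + 1) * m), Real.cos 1 / ((K + 1) * m) := by
        rw [Finset.sum_const, Nat.card_Ioc, ← Nat.sub_mul, Nat.add_sub_cancel_left, one_mul,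
          nsmul_eq_mul]
        field_simp
    _ ≤ (Complex.exp ((s.im * Real.log (K * m : ℕ) : ℝ) * I) *
          ∑ n ∈ Finset.Ioc (K * m) ((K + 1) * m), 1 / (n : ℂ) ^ s).re := by
        rw [Finset.mul_sum, Complex.re_sum]
        exact Finset.sum_le_sum hterm
    _ ≤ _ := by
        refine (Complex.re_le_norm _).trans_eq ?_
        rw [norm_mul, Complex.norm_exp_ofReal_mul_I, one_mul]

/-- For every complex `s` with `Re s ≤ 1`, the Dirichlet series `∑ 1/n^s` diverges:
its sequence of partial sums `N ↦ ∑_{n=1}^N n^(-s)` has no limit in `ℂ`.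
In particular it diverges throughout the critical strip `0 < Re s < 1`. -/
theorem dirichlet_series_diverges_of_re_le_one (s : ℂ) (hs : s.re ≤ 1) :
    ¬ ∃ L : ℂ, Tendsto (fun N : ℕ => ∑ n ∈ Finset.Icc 1 N, 1 / (n : ℂ) ^ s)
      atTop (𝓝 L) := by
  rintro ⟨L, hL⟩
  obtain ⟨k, hk⟩ := exists_nat_ge |s.im|
  have hKs : |s.im| ≤ (k + 1 : ℕ) := by push_cast; linarith
  generalize hK : k + 1 = K at hKs
  have hK0 : 0 < K := by omega
  have hblock : Tendsto (fun m : ℕ => ‖∑ n ∈ Finset.Ioc (K * m) ((K + 1) * m), 1 / (n : ℂ) ^ s‖)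
      atTop (𝓝 0) := by
    have h := ((hL.comp (tendsto_id.const_mul_atTop' K.succ_pos)).sub
      (hL.comp (tendsto_id.const_mul_atTop' hK0))).norm
    rw [sub_self, norm_zero] at h
    refine h.congr fun m => ?_
    have hle : K * m ≤ (K + 1) * m := Nat.mul_le_mul_right m K.le_succ
    have hsum := Finset.sum_Ioc_consecutive (fun n : ℕ => 1 / (n : ℂ) ^ s) (Nat.zero_le _) hle
    have hIcc : ∀ N : ℕ, Finset.Icc 1 N = Finset.Ioc 0 N := fun N => by ext; simp; omega
    simp only [Function.comp_apply, id_eq, hIcc, Nat.succ_eq_add_one]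
    rw [← hsum, add_sub_cancel_left]
  have hle : Real.cos 1 / (K + 1) ≤ 0 := ge_of_tendsto hblock <|
    (eventually_gt_atTop 0).mono fun m hm =>
      cos_one_div_le_norm_sum_Ioc_one_div_cpow hs hK0 hKs hm
  have hpos : 0 < Real.cos 1 / (K + 1) := div_pos Real.cos_one_pos (by positivity)
  exact hpos.not_ge hle
end

section
/- For every complex number s with Re(s) > −1 and s ≠ 1, the sequence N ↦ ∑_{n=1}^N n^{-s} − N^{1−s}/(1−s) − (1/2) N^{-s} converges to ζ(s) as N → ∞. -/
open Complex Real Filter Topology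

/-- Error bound for the trapezoidal rule on an interval of length one, stated in terms of a
primitive `G` of `f`. -/
lemma norm_trapezoid_sub_le {G f f' f'' : ℝ → ℂ} {a C : ℝ}
    (hG : ∀ x ∈ Set.Icc a (a + 1), HasDerivAt G (f x) x)
    (hf : ∀ x ∈ Set.Icc a (a + 1), HasDerivAt f (f' x) x)
    (hf' : ∀ x ∈ Set.Icc a (a + 1), HasDerivAt f' (f'' x) x)
    (hC : ∀ x ∈ Set.Icc a (a + 1), ‖f'' x‖ ≤ C) :
    ‖1 / 2 * (f a + f (a + 1)) - (G (a + 1) - G a)‖ ≤ C / 2 := by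
  have hC0 : 0 ≤ C := (norm_nonneg _).trans (hC a ⟨le_rfl, by linarith⟩)
  have hlin (x : ℝ) : HasDerivAt (fun y : ℝ ↦ ((y : ℂ) - a) / 2) (1 / 2) x :=
    ((hasDerivAt_id (x : ℂ)).sub_const (a : ℂ)).div_const 2 |>.comp_ofReal
  have hderiv : ∀ x ∈ Set.Icc a (a + 1),
      ‖1 / 2 * (f a - f x) + ((x : ℂ) - a) / 2 * f' x‖ ≤ C / 2 := by
    intro x hx
    have key := norm_image_sub_le_of_norm_deriv_le_segment' (a := a) (b := a + 1)
      (f := fun y ↦ 1 / 2 * (f a - f y) + ((y : ℂ) - a) / 2 * f' y)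
      (f' := fun y ↦ ((y : ℂ) - a) / 2 * f'' y) (C := C / 2)
      (fun y hy ↦ by
        refine HasDerivAt.hasDerivWithinAt ?_
        exact ((((hf y hy).const_sub (f a)).const_mul (1 / 2 : ℂ)).add
          ((hlin y).mul (hf' y hy))).congr_deriv (by ring))
      (fun y hy ↦ by
        have h1 : ‖((y : ℂ) - a) / 2‖ ≤ 1 / 2 := by
          rw [← ofReal_sub, norm_div, norm_real, Real.norm_of_nonneg (by linarith [hy.1]),
            Complex.norm_ofNat]
          linarith [hy.2]
        rw [norm_mul]
        calc _ ≤ 1 / 2 * C := by gcongr; exact hC y ⟨hy.1, hy.2.le⟩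
          _ = C / 2 := by ring) x hx
    simp only [sub_self, zero_div, zero_mul, mul_zero, add_zero, sub_zero] at key
    exact key.trans (mul_le_of_le_one_right (by positivity) (by linarith [hx.2]))
  have key := norm_image_sub_le_of_norm_deriv_le_segment' (a := a) (b := a + 1)
    (f := fun y ↦ ((y : ℂ) - a) / 2 * (f a + f y) - (G y - G a))
    (f' := fun y ↦ 1 / 2 * (f a - f y) + ((y : ℂ) - a) / 2 * f' y) (C := C / 2)
    (fun y hy ↦ by
      refine HasDerivAt.hasDerivWithinAt ?_
      exact (((hlin y).mul ((hf y hy).const_add (f a))).sub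
        ((hG y hy).sub_const (G a))).congr_deriv (by ring))
    (fun y hy ↦ hderiv y ⟨hy.1, hy.2.le⟩) (a + 1) ⟨by linarith, le_rfl⟩
  simpa using key

/-- `(1 - s)` times the difference between the trapezoidal approximation and the exact value of
the integral of `x ^ (-s)` over `[n + 1, n + 2]`. It is entire in `s`. -/
noncomputable def zetaTrapezoidTerm (n : ℕ) (s : ℂ) : ℂ :=
  1 / 2 * ((1 - s) * ((n + 1 : ℕ) : ℂ) ^ (-s) + (1 - s) * ((n + 2 : ℕ) : ℂ) ^ (-s))
    - (((n + 2 : ℕ) : ℂ) ^ (1 - s) - ((n + 1 : ℕ) : ℂ) ^ (1 - s))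

lemma differentiable_zetaTrapezoidTerm (n : ℕ) : Differentiable ℂ (zetaTrapezoidTerm n) := by
  have h (m : ℕ) (g : ℂ → ℂ) (hg : Differentiable ℂ g) :
      Differentiable ℂ fun s ↦ ((m + 1 : ℕ) : ℂ) ^ g s :=
    hg.const_cpow (Or.inl (Nat.cast_ne_zero.mpr m.succ_ne_zero))
  have h1 := h n (fun s ↦ -s) (by fun_prop)
  have h2 := h (n + 1) (fun s ↦ -s) (by fun_prop)
  have h3 := h n (fun s ↦ 1 - s) (by fun_prop)
  have h4 := h (n + 1) (fun s ↦ 1 - s) (by fun_prop)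
  unfold zetaTrapezoidTerm
  fun_prop

lemma norm_zetaTrapezoidTerm_le {c : ℝ} (hc : -1 < c) {s : ℂ} (hs : c < s.re) (n : ℕ) :
    ‖zetaTrapezoidTerm n s‖ ≤
      ‖1 - s‖ * ‖s‖ * ‖s + 1‖ / 2 * ((n + 1 : ℕ) : ℝ) ^ (-c - 2) := by
  have hpos : (0 : ℝ) < ((n + 1 : ℕ) : ℝ) := by positivity
  have hpow (r : ℂ) {x : ℝ} (hx : 0 < x) :
      HasDerivAt (fun y : ℝ ↦ (y : ℂ) ^ r) (r * (x : ℂ) ^ (r - 1)) x := by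
    simpa using ((hasDerivAt_id (x : ℂ)).cpow_const (c := r)
      (Or.inl (by simpa using hx))).comp_ofReal
  have key := norm_trapezoid_sub_le (a := ((n + 1 : ℕ) : ℝ))
    (G := fun x ↦ (x : ℂ) ^ (1 - s)) (f := fun x ↦ (1 - s) * (x : ℂ) ^ (-s))
    (f' := fun x ↦ (1 - s) * (-s * (x : ℂ) ^ (-s - 1)))
    (f'' := fun x ↦ (1 - s) * (-s * ((-s - 1) * (x : ℂ) ^ (-s - 1 - 1))))
    (C := ‖1 - s‖ * ‖s‖ * ‖s + 1‖ * ((n + 1 : ℕ) : ℝ) ^ (-c - 2))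
    (fun x hx ↦ by
      convert hpow (1 - s) (hpos.trans_le hx.1) using 3
      ring)
    (fun x hx ↦ (hpow (-s) (hpos.trans_le hx.1)).const_mul _)
    (fun x hx ↦ ((hpow (-s - 1) (hpos.trans_le hx.1)).const_mul _).const_mul _)
    (fun x hx ↦ by
      have hx0 := hpos.trans_le hx.1
      have h1 : (1 : ℝ) ≤ ((n + 1 : ℕ) : ℝ) := by simp
      rw [norm_mul, norm_mul, norm_mul, norm_neg, norm_cpow_eq_rpow_re_of_pos hx0,
        ← norm_neg (-s - 1), show -(-s - 1) = s + 1 by ring, ← mul_assoc, ← mul_assoc]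
      gcongr
      calc x ^ (-s - 1 - 1).re ≤ x ^ (-c - 2) := by
            apply Real.rpow_le_rpow_of_exponent_le (h1.trans hx.1)
            simp only [sub_re, neg_re, one_re]
            linarith
        _ ≤ _ := Real.rpow_le_rpow_of_nonpos hpos hx.1 (by linarith))
  convert key using 1
  · simp only [zetaTrapezoidTerm]
    push_cast
    rw [show (n : ℂ) + 2 = n + 1 + 1 by ring]
  · ring

lemma sum_zetaTrapezoidTerm {s : ℂ} (hs : s ≠ 1) (N : ℕ) :
    ∑ n ∈ Finset.range N, zetaTrapezoidTerm n s =
      (1 - s) * ((∑ n ∈ Finset.Icc 1 (N + 1), 1 / (n : ℂ) ^ s)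
        - ((N + 1 : ℕ) : ℂ) ^ (1 - s) / (1 - s) - (1 / 2) * ((N + 1 : ℕ) : ℂ) ^ (-s))
      + (1 + s) / 2 := by
  have hs' : 1 - s ≠ 0 := sub_ne_zero.mpr hs.symm
  induction N with
  | zero =>
    simp
    field_simp
    ring
  | succ N ih =>
    rw [Finset.sum_range_succ, ih, Finset.sum_Icc_succ_top (by omega : 1 ≤ N + 1 + 1),
      zetaTrapezoidTerm, one_div (((N + 1 + 1 : ℕ) : ℂ) ^ s), ← cpow_neg]
    field_simp
    ring

lemma summable_zetaTrapezoidTerm_bound {c : ℝ} (hc : -1 < c) (K : ℝ) :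
    Summable fun n : ℕ ↦ K * ((n + 1 : ℕ) : ℝ) ^ (-c - 2) :=
  ((summable_nat_add_iff 1).mpr
    (Real.summable_nat_rpow.mpr (by linarith : -c - 2 < -1))).mul_left K

lemma tendsto_natCast_cpow_zero {r : ℂ} (hr : r.re < 0) :
    Tendsto (fun N : ℕ ↦ (N : ℂ) ^ r) atTop (𝓝 0) := by
  rw [tendsto_zero_iff_norm_tendsto_zero]
  have h := (tendsto_rpow_neg_atTop (neg_pos.mpr hr)).comp tendsto_natCast_atTop_atTop
  refine h.congr' ?_
  filter_upwards [eventually_gt_atTop 0] with N hN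
  simp [norm_natCast_cpow_of_pos hN]

lemma tendsto_zeta_partial_sum_of_one_lt_re {s : ℂ} (hs : 1 < s.re) :
    Tendsto
      (fun N : ℕ => (∑ n ∈ Finset.Icc 1 N, 1 / (n : ℂ) ^ s) - (N : ℂ) ^ (1 - s) / (1 - s)
        - (1 / 2) * (N : ℂ) ^ (-s))
      atTop (𝓝 (riemannZeta s)) := by
  have hsum : Tendsto (fun N : ℕ => ∑ n ∈ Finset.Icc 1 N, 1 / (n : ℂ) ^ s) atTop
      (𝓝 (riemannZeta s)) := by
    rw [zeta_eq_tsum_one_div_nat_add_one_cpow hs]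
    have h := (((summable_nat_add_iff 1).mpr
      (Complex.summable_one_div_nat_cpow.mpr hs)).hasSum).tendsto_sum_nat
    simp only [← Nat.cast_add_one]
    refine h.congr fun N ↦ ?_
    rw [Finset.range_eq_Ico, Finset.sum_Ico_add' (fun n : ℕ ↦ 1 / (n : ℂ) ^ s) 0 N 1]
    rfl
  have h1 := (tendsto_natCast_cpow_zero (r := 1 - s) (by simpa using hs)).div_const (1 - s)
  have h2 := (tendsto_natCast_cpow_zero (r := -s) (by rw [neg_re]; linarith)).const_mul (1 / 2 : ℂ)
  simpa using (hsum.sub h1).sub h2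

lemma summable_zetaTrapezoidTerm {s : ℂ} (hs : -1 < s.re) :
    Summable fun n ↦ zetaTrapezoidTerm n s := by
  obtain ⟨c, hc, hcs⟩ := exists_between hs
  exact (summable_zetaTrapezoidTerm_bound hc _).of_norm_bounded
    (norm_zetaTrapezoidTerm_le hc hcs)

lemma tendsto_zeta_partial_sum_tsum {s : ℂ} (h0 : -1 < s.re) (h1 : s ≠ 1) :
    Tendsto
      (fun N : ℕ => (∑ n ∈ Finset.Icc 1 N, 1 / (n : ℂ) ^ s) - (N : ℂ) ^ (1 - s) / (1 - s)
        - (1 / 2) * (N : ℂ) ^ (-s))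
      atTop (𝓝 (((∑' n, zetaTrapezoidTerm n s) - (1 + s) / 2) / (1 - s))) := by
  have hs' : 1 - s ≠ 0 := sub_ne_zero.mpr h1.symm
  rw [← tendsto_add_atTop_iff_nat 1]
  have h := ((summable_zetaTrapezoidTerm h0).hasSum.tendsto_sum_nat.sub_const
    ((1 + s) / 2)).div_const (1 - s)
  refine h.congr fun N ↦ ?_
  rw [sum_zetaTrapezoidTerm h1, add_sub_cancel_right, mul_div_cancel_left₀ _ hs']

lemma tsum_zetaTrapezoidTerm {s : ℂ} (hs : -1 < s.re) :
    ∑' n, zetaTrapezoidTerm n s = (1 + s) / 2 - riemannZeta₁ s := by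
  obtain ⟨c, hc, hcs⟩ := exists_between (lt_min hs (by norm_num : (-1 : ℝ) < 1))
  rw [lt_min_iff] at hcs
  set R := ‖s‖ + 3
  have hR : 0 < R := by positivity
  set V : Set ℂ := {z | c < z.re} ∩ Metric.ball 0 R
  have hVo : IsOpen V := (isOpen_lt continuous_const continuous_re).inter Metric.isOpen_ball
  have hVc : IsPreconnected V :=
    ((convex_halfSpace_re_gt c).inter (convex_ball 0 R)).isPreconnected
  have h2V : (2 : ℂ) ∈ V := by
    refine ⟨?_, ?_⟩
    · simp only [Set.mem_ofPred_eq, re_ofNat]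
      linarith
    · simp only [Metric.mem_ball, dist_zero_right, Complex.norm_ofNat, R]
      linarith [norm_nonneg s]
  have hsV : s ∈ V := ⟨hcs.1, by simp [R]⟩
  have hdiff : DifferentiableOn ℂ (fun z ↦ ∑' n, zetaTrapezoidTerm n z) V := by
    refine differentiableOn_tsum_of_summable_norm
      (summable_zetaTrapezoidTerm_bound hc ((1 + R) * R * (R + 1) / 2))
      (fun n ↦ (differentiable_zetaTrapezoidTerm n).differentiableOn) hVo fun n z hz ↦ ?_
    refine (norm_zetaTrapezoidTerm_le hc hz.1 n).trans ?_
    have hzR : ‖z‖ ≤ R := (mem_ball_zero_iff.mp hz.2).le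
    gcongr
    · exact (norm_sub_le _ _).trans (by simpa using hzR)
    · exact (norm_add_le _ _).trans (by simpa using hzR)
  have hdiff' : DifferentiableOn ℂ (fun z ↦ (1 + z) / 2 - riemannZeta₁ z) V := by
    apply Differentiable.differentiableOn
    fun_prop
  refine (hdiff.analyticOnNhd hVo).eqOn_of_preconnected_of_eventuallyEq
    (hdiff'.analyticOnNhd hVo) hVc h2V ?_ hsV
  filter_upwards [(isOpen_lt continuous_const continuous_re).mem_nhds
    (by simp : (2 : ℂ) ∈ {z : ℂ | 1 < z.re})] with z hz
  have hz : 1 < z.re := hz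
  have hz1 : z ≠ 1 := by
    rintro rfl
    simp at hz
  have hz1' : z - 1 ≠ 0 := sub_ne_zero.mpr hz1
  have hz1'' : 1 - z ≠ 0 := sub_ne_zero.mpr hz1.symm
  have h := tendsto_nhds_unique (tendsto_zeta_partial_sum_of_one_lt_re hz)
    (tendsto_zeta_partial_sum_tsum (by linarith) hz1)
  rw [riemannZeta_eq_inv_sub_mul hz1, eq_div_iff hz1''] at h
  have h3 : (z - 1)⁻¹ * riemannZeta₁ z * (1 - z) = -riemannZeta₁ z := by
    field_simp
    ring
  rw [h3] at h
  linear_combination -h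

/-- For every complex `s` with `Re s > -1` and `s ≠ 1`,
`∑_{n=1}^N n^(-s) - N^(1-s)/(1-s) - (1/2) N^(-s) → ζ(s)` as `N → ∞`. -/
theorem zeta_asymptotic_formula_two (s : ℂ) (h0 : -1 < s.re) (h1 : s ≠ 1) :
    Tendsto
      (fun N : ℕ => (∑ n ∈ Finset.Icc 1 N, 1 / (n : ℂ) ^ s) - (N : ℂ) ^ (1 - s) / (1 - s)
        - (1 / 2) * (N : ℂ) ^ (-s))
      atTop (𝓝 (riemannZeta s)) := by
  have h := tendsto_zeta_partial_sum_tsum h0 h1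
  have h1' : s - 1 ≠ 0 := sub_ne_zero.mpr h1
  have h1'' : 1 - s ≠ 0 := sub_ne_zero.mpr h1.symm
  convert h using 2
  rw [tsum_zetaTrapezoidTerm h0, riemannZeta_eq_inv_sub_mul h1]
  field_simp
  ring
end

section
/- For every complex number s with Re(s) > −2 and s ≠ 1, the sequence N ↦ ∑_{n=1}^N n^{-s} − N^{1−s}/(1−s) − (1/2) N^{-s} + (s/12) N^{−1−s} converges to ζ(s) as N → ∞. -/
open Complex Real Filter Topology

lemma hasDerivAt_ofReal_add_cpow {x t : ℝ} (hxt : 0 < x + t) (c : ℂ) :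
    HasDerivAt (fun t : ℝ => ((x + t : ℝ) : ℂ) ^ c) (c * ((x + t : ℝ) : ℂ) ^ (c - 1)) t := by
  have h : HasDerivAt (fun t : ℝ => ((x + t : ℝ) : ℂ)) 1 t := by
    simpa using ((hasDerivAt_id t).const_add x).ofReal_comp
  have h' : HasDerivAt (fun z : ℂ => z ^ c) (c * ((x + t : ℝ) : ℂ) ^ (c - 1))
      ((x + t : ℝ) : ℂ) := by
    simpa using (hasDerivAt_id ((x + t : ℝ) : ℂ)).cpow_const (c := c)
      (ofReal_mem_slitPlane.2 hxt)
  exact (h'.comp t h).congr_deriv (mul_one _)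

lemma norm_le_of_hasDerivAt_of_norm_le {g g' : ℝ → ℂ} {C : ℝ} (h0 : g 0 = 0)
    (hg : ∀ t ∈ Set.Icc (0 : ℝ) 1, HasDerivAt g (g' t) t)
    (hC : ∀ t ∈ Set.Icc (0 : ℝ) 1, ‖g' t‖ ≤ C) :
    ∀ t ∈ Set.Icc (0 : ℝ) 1, ‖g t‖ ≤ C := by
  intro t ht
  have hC0 : 0 ≤ C := (norm_nonneg _).trans (hC t ht)
  have := norm_image_sub_le_of_norm_deriv_le_segment'
    (fun u hu => (hg u hu).hasDerivWithinAt) (fun u hu => hC u ⟨hu.1, hu.2.le⟩) t ht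
  rw [h0, sub_zero, sub_zero] at this
  exact this.trans (mul_le_of_le_one_right hC0 ht.2)

/-- The Euler–Maclaurin partial sums of `(s - 1) * ζ(s)`; multiplying by `s - 1` removes the pole
at `1`. -/
noncomputable def eulerMaclaurinSum (N : ℕ) (s : ℂ) : ℂ :=
  (s - 1) * (∑ n ∈ Finset.Icc 1 N, 1 / (n : ℂ) ^ s) + (N : ℂ) ^ (1 - s)
    - (s - 1) / 2 * (N : ℂ) ^ (-s) + (s - 1) * s / 12 * (N : ℂ) ^ (-1 - s)

/-- The local error term of the Euler–Maclaurin formula is controlled by its third derivative in the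
length `t` of the interval. -/
lemma norm_eulerMaclaurin_step_le {x : ℝ} (hx : 1 ≤ x) {s : ℂ} (hs : -2 < s.re) :
    ‖((x + 1 : ℝ) : ℂ) ^ (1 - s) - (x : ℂ) ^ (1 - s)
      + (s - 1) / 2 * ((x : ℂ) ^ (-s) + ((x + 1 : ℝ) : ℂ) ^ (-s))
      + (s - 1) * s / 12 * (((x + 1 : ℝ) : ℂ) ^ (-1 - s) - (x : ℂ) ^ (-1 - s))‖
      ≤ ‖(s - 1) * s * (s + 1) * (s + 2) * (s + 3)‖ * x ^ (-2 : ℝ) := by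
  let E (c : ℂ) (t : ℝ) : ℂ := ((x + t : ℝ) : ℂ) ^ c
  have hE (c d : ℂ) (hcd : c - 1 = d) (t : ℝ) (ht : t ∈ Set.Icc (0 : ℝ) 1) :
      HasDerivAt (E c) (c * E d t) t := by
    subst hcd
    exact hasDerivAt_ofReal_add_cpow (by linarith [ht.1]) c
  have hE0 (c : ℂ) : E c 0 = (x : ℂ) ^ c := by simp [E]
  let P (t : ℝ) : ℂ := E (1 - s) t - E (1 - s) 0
      + (s - 1) / 2 * ((t : ℂ) * (E (-s) 0 + E (-s) t))
      + (s - 1) * s / 12 * ((t : ℂ) ^ 2 * (E (-1 - s) t - E (-1 - s) 0))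
  let P1 (t : ℝ) : ℂ := (s - 1) * ((E (-s) 0 - E (-s) t) / 2
      - s / 3 * ((t : ℂ) * E (-1 - s) t) - s / 6 * E (-1 - s) 0 * (t : ℂ)
      - s * (s + 1) / 12 * ((t : ℂ) ^ 2 * E (-2 - s) t))
  let P2 (t : ℝ) : ℂ := (s - 1) * (s / 6 * (E (-1 - s) t - E (-1 - s) 0)
      + s * (s + 1) / 6 * ((t : ℂ) * E (-2 - s) t)
      + s * (s + 1) * (s + 2) / 12 * ((t : ℂ) ^ 2 * E (-3 - s) t))
  let P3 (t : ℝ) : ℂ :=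
    -((s - 1) * s * (s + 1) * (s + 2) * (s + 3)) * ((t : ℂ) ^ 2 / 12 * E (-4 - s) t)
  have hid (t : ℝ) : HasDerivAt (fun t : ℝ => (t : ℂ)) 1 t := by
    simpa using (hasDerivAt_id t).ofReal_comp
  have hsq (t : ℝ) : HasDerivAt (fun t : ℝ => (t : ℂ) ^ 2) (2 * t) t := by
    exact ((hid t).pow 2).congr_deriv (by simp)
  have d0 : ∀ t ∈ Set.Icc (0 : ℝ) 1, HasDerivAt P (P1 t) t := by
    intro t ht
    have e0 := hE (1 - s) (-s) (by ring) t ht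
    have e1 := hE (-s) (-1 - s) (by ring) t ht
    have e2 := hE (-1 - s) (-2 - s) (by ring) t ht
    refine HasDerivAt.congr_deriv (((e0.sub_const (E (1 - s) 0)).add
      (((hid t).mul (e1.const_add (E (-s) 0))).const_mul ((s - 1) / 2))).add
      (((hsq t).mul (e2.sub_const (E (-1 - s) 0))).const_mul ((s - 1) * s / 12))) ?_
    simp only [P1]
    ring
  have d1 : ∀ t ∈ Set.Icc (0 : ℝ) 1, HasDerivAt P1 (P2 t) t := by
    intro t ht
    have e1 := hE (-s) (-1 - s) (by ring) t ht
    have e2 := hE (-1 - s) (-2 - s) (by ring) t ht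
    have e3 := hE (-2 - s) (-3 - s) (by ring) t ht
    refine HasDerivAt.congr_deriv (((((e1.const_sub (E (-s) 0)).div_const 2).sub
      (((hid t).mul e2).const_mul (s / 3))).sub
      ((hid t).const_mul (s / 6 * E (-1 - s) 0))).sub
      (((hsq t).mul e3).const_mul (s * (s + 1) / 12)) |>.const_mul (s - 1)) ?_
    simp only [P2]
    ring
  have d2 : ∀ t ∈ Set.Icc (0 : ℝ) 1, HasDerivAt P2 (P3 t) t := by
    intro t ht
    have e2 := hE (-1 - s) (-2 - s) (by ring) t ht
    have e3 := hE (-2 - s) (-3 - s) (by ring) t ht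
    have e4 := hE (-3 - s) (-4 - s) (by ring) t ht
    refine HasDerivAt.congr_deriv ((((e2.sub_const (E (-1 - s) 0)).const_mul (s / 6)).add
      (((hid t).mul e3).const_mul (s * (s + 1) / 6))).add
      (((hsq t).mul e4).const_mul (s * (s + 1) * (s + 2) / 12)) |>.const_mul (s - 1)) ?_
    simp only [P3]
    ring
  have b3 : ∀ t ∈ Set.Icc (0 : ℝ) 1,
      ‖P3 t‖ ≤ ‖(s - 1) * s * (s + 1) * (s + 2) * (s + 3)‖ * x ^ (-2 : ℝ) := by
    intro t ht
    have hxt : 1 ≤ x + t := by linarith [ht.1]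
    have hEn : ‖E (-4 - s) t‖ ≤ x ^ (-2 : ℝ) := by
      rw [norm_cpow_eq_rpow_re_of_pos (by linarith)]
      calc (x + t) ^ (-4 - s).re ≤ (x + t) ^ (-2 : ℝ) := by
            refine Real.rpow_le_rpow_of_exponent_le hxt ?_
            simp only [sub_re, neg_re, re_ofNat]
            linarith
        _ ≤ x ^ (-2 : ℝ) :=
            Real.rpow_le_rpow_of_nonpos (by linarith) (by linarith [ht.1]) (by norm_num)
    have ht2 : ‖(t : ℂ) ^ 2 / 12‖ ≤ 1 := by
      rw [norm_div, norm_pow, norm_real, Real.norm_of_nonneg ht.1]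
      norm_num
      nlinarith [ht.1, ht.2]
    simp only [P3]
    rw [norm_mul, norm_neg, norm_mul]
    refine mul_le_mul_of_nonneg_left ?_ (by positivity)
    rw [norm_mul]
    exact (mul_le_of_le_one_left (norm_nonneg _) ht2).trans hEn
  have b2 := norm_le_of_hasDerivAt_of_norm_le (by simp [P2]) d2 b3
  have b1 := norm_le_of_hasDerivAt_of_norm_le (by simp [P1]) d1 b2
  have b0 := norm_le_of_hasDerivAt_of_norm_le (by simp [P]) d0 b1 1 (by simp)
  simpa only [P, hE0, E, ofReal_one, one_mul, one_pow] using b0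

lemma norm_eulerMaclaurinSum_succ_sub_le {N : ℕ} (hN : 1 ≤ N) {s : ℂ} (hs : -2 < s.re) :
    ‖eulerMaclaurinSum (N + 1) s - eulerMaclaurinSum N s‖
      ≤ ‖(s - 1) * s * (s + 1) * (s + 2) * (s + 3)‖ * (N : ℝ) ^ (-2 : ℝ) := by
  refine le_of_eq_of_le (congrArg norm ?_)
    (norm_eulerMaclaurin_step_le (x := N) (by exact_mod_cast hN) hs)
  simp only [eulerMaclaurinSum, Finset.sum_Icc_succ_top (Nat.le_add_left 1 N), one_div,
    ← cpow_neg]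
  push_cast
  ring

lemma differentiable_eulerMaclaurinSum {N : ℕ} (hN : N ≠ 0) :
    Differentiable ℂ (eulerMaclaurinSum N) := by
  have h (n : ℕ) (hn : n ≠ 0) {f : ℂ → ℂ} (hf : Differentiable ℂ f) :
      Differentiable ℂ (fun s => (n : ℂ) ^ f s) :=
    hf.const_cpow (Or.inl (Nat.cast_ne_zero.2 hn))
  have hsum : Differentiable ℂ (fun s : ℂ => ∑ n ∈ Finset.Icc 1 N, 1 / (n : ℂ) ^ s) := by
    simp only [one_div, ← cpow_neg]
    refine Differentiable.fun_sum fun n hn => h n ?_ (by fun_prop)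
    have := (Finset.mem_Icc.1 hn).1
    omega
  have h1 := h N hN (f := fun s => 1 - s) (by fun_prop)
  have h2 := h N hN (f := fun s => -s) (by fun_prop)
  have h3 := h N hN (f := fun s => -1 - s) (by fun_prop)
  unfold eulerMaclaurinSum
  fun_prop

lemma tendsto_natCast_cpow_of_re_neg {c : ℂ} (hc : c.re < 0) :
    Tendsto (fun N : ℕ => (N : ℂ) ^ c) atTop (𝓝 0) := by
  rw [tendsto_zero_iff_norm_tendsto_zero]
  have h := (tendsto_rpow_neg_atTop (neg_pos.2 hc)).comp tendsto_natCast_atTop_atTop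
  refine h.congr' ?_
  filter_upwards [eventually_gt_atTop 0] with N hN
  simp [norm_natCast_cpow_of_pos hN]

lemma tendsto_eulerMaclaurinSum_of_one_lt_re {s : ℂ} (hs : 1 < s.re) :
    Tendsto (fun N => eulerMaclaurinSum N s) atTop (𝓝 ((s - 1) * riemannZeta s)) := by
  have hsum : Tendsto (fun N : ℕ => ∑ n ∈ Finset.Icc 1 N, 1 / (n : ℂ) ^ s) atTop
      (𝓝 (riemannZeta s)) := by
    have h := (summable_one_div_nat_cpow.2 hs).hasSum.tendsto_sum_nat.comp (tendsto_add_atTop_nat 1)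
    rw [← zeta_eq_tsum_one_div_nat_cpow hs] at h
    refine h.congr fun N => ?_
    have hs0 : s ≠ 0 := by
      rintro rfl
      norm_num at hs
    rw [Function.comp_apply, Finset.range_eq_Ico, Finset.sum_eq_sum_Ico_succ_bot (by omega)]
    simp [hs0, ← Finset.Ico_add_one_right_eq_Icc]
  have h1 := tendsto_natCast_cpow_of_re_neg (c := 1 - s) (by simpa using hs)
  have h2 := tendsto_natCast_cpow_of_re_neg (c := -s) (by simp; linarith)
  have h3 := tendsto_natCast_cpow_of_re_neg (c := -1 - s) (by simp; linarith)
  simpa [eulerMaclaurinSum] using (((hsum.const_mul (s - 1)).add h1).sub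
    (h2.const_mul ((s - 1) / 2))).add (h3.const_mul ((s - 1) * s / 12))

lemma sub_one_mul_riemannZeta {s : ℂ} (hs : s ≠ 1) :
    (s - 1) * riemannZeta s = riemannZeta₁ s := by
  rw [riemannZeta_eq_inv_sub_mul hs, mul_inv_cancel_left₀ (sub_ne_zero.2 hs)]

lemma tendsto_eulerMaclaurinSum {s : ℂ} (hs : -2 < s.re) :
    Tendsto (fun N => eulerMaclaurinSum N s) atTop (𝓝 (riemannZeta₁ s)) := by
  let R : ℝ := ‖s‖ + 3
  have hR : 0 ≤ R := by positivity
  let U : Set ℂ := {z | -2 < z.re} ∩ Metric.ball 0 R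
  have hUo : IsOpen U := (isOpen_lt continuous_const continuous_re).inter Metric.isOpen_ball
  have hUc : IsPreconnected U :=
    ((convex_halfSpace_re_gt (-2)).inter (convex_ball 0 R)).isPreconnected
  let C : ℝ := (R + 1) * R * (R + 1) * (R + 2) * (R + 3)
  let u (n : ℕ) : ℝ := C * ((n + 1 : ℕ) : ℝ) ^ (-2 : ℝ)
  let d (n : ℕ) (z : ℂ) : ℂ := eulerMaclaurinSum (n + 1 + 1) z - eulerMaclaurinSum (n + 1) z
  have hu : Summable u :=
    ((summable_nat_add_iff 1).2 (Real.summable_nat_rpow.2 (by norm_num))).mul_left C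
  have hdu (n : ℕ) (z : ℂ) (hz : z ∈ U) : ‖d n z‖ ≤ u n := by
    refine (norm_eulerMaclaurinSum_succ_sub_le (Nat.le_add_left 1 n) hz.1).trans ?_
    have hzR : ‖z‖ ≤ R := (mem_ball_zero_iff.1 hz.2).le
    simp only [norm_mul, u, C]
    gcongr
    · exact (norm_sub_le _ _).trans (by simpa using hzR)
    · exact (norm_add_le _ _).trans (by simpa using hzR)
    · exact (norm_add_le _ _).trans (by simpa using hzR)
    · exact (norm_add_le _ _).trans (by simpa using hzR)
  let g (z : ℂ) : ℂ := eulerMaclaurinSum 1 z + ∑' n, d n z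
  have hg : DifferentiableOn ℂ g U :=
    (differentiable_eulerMaclaurinSum one_ne_zero).differentiableOn.add
      (differentiableOn_tsum_of_summable_norm hu
        (fun n => ((differentiable_eulerMaclaurinSum (by omega)).sub
          (differentiable_eulerMaclaurinSum (by omega))).differentiableOn) hUo hdu)
  have hlim (z : ℂ) (hz : z ∈ U) : Tendsto (fun N => eulerMaclaurinSum N z) atTop (𝓝 (g z)) := by
    have hsum : Summable fun n => d n z := .of_norm_bounded hu fun n => hdu n z hz
    rw [← tendsto_add_atTop_iff_nat 1]
    refine (hsum.hasSum.tendsto_sum_nat.const_add (eulerMaclaurinSum 1 z)).congr fun N => ?_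
    simp only [d]
    rw [Finset.sum_range_sub (fun n => eulerMaclaurinSum (n + 1) z)]
    simp
  have h2 : (2 : ℂ) ∈ U := by
    refine ⟨by simp, ?_⟩
    simp only [Metric.mem_ball, dist_zero_right, Complex.norm_ofNat, R]
    linarith [norm_nonneg s]
  have heq : Set.EqOn g riemannZeta₁ U := by
    refine (hg.analyticOnNhd hUo).eqOn_of_preconnected_of_eventuallyEq
      (differentiable_riemannZeta₁.differentiableOn.analyticOnNhd hUo) hUc h2 ?_
    filter_upwards [hUo.mem_nhds h2,
      (isOpen_lt continuous_const continuous_re).mem_nhds (by simp : (1 : ℝ) < (2 : ℂ).re)]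
      with z hzU (hz : 1 < z.re)
    rw [← sub_one_mul_riemannZeta (by rintro rfl; simp at hz)]
    exact tendsto_nhds_unique (hlim z hzU) (tendsto_eulerMaclaurinSum_of_one_lt_re hz)
  have hsU : s ∈ U := ⟨hs, by simp [R]⟩
  rw [← heq hsU]
  exact hlim s hsU

/-- For every complex `s` with `Re s > -2` and `s ≠ 1`,
`∑_{n=1}^N n^(-s) - N^(1-s)/(1-s) - (1/2) N^(-s) + (s/12) N^(-1-s) → ζ(s)` as `N → ∞`. -/
theorem zeta_asymptotic_formula_three (s : ℂ) (h0 : -2 < s.re) (h1 : s ≠ 1) :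
    Tendsto
      (fun N : ℕ => (∑ n ∈ Finset.Icc 1 N, 1 / (n : ℂ) ^ s) - (N : ℂ) ^ (1 - s) / (1 - s)
        - (1 / 2) * (N : ℂ) ^ (-s) + (s / 12) * (N : ℂ) ^ (-1 - s))
      atTop (𝓝 (riemannZeta s)) := by
  rw [riemannZeta_eq_inv_sub_mul h1]
  refine ((tendsto_eulerMaclaurinSum h0).const_mul (s - 1)⁻¹).congr fun N => ?_
  have hs : s - 1 ≠ 0 := sub_ne_zero.2 h1
  have hs' : 1 - s ≠ 0 := sub_ne_zero.2 h1.symm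
  simp only [eulerMaclaurinSum]
  field_simp
  ring
end

section
/- For every real C > 1 there exists a constant K > 0 such that for all complex s = σ + it with σ > 0 and s ≠ 1, and all real x ≥ 1 satisfying |t| ≤ 2πx/C, one has |ζ(s) − (∑_{n ≤ x} n^{-s} − x^{1−s}/(1−s))| ≤ K · x^{−σ}, where the sum runs over positive integers n ≤ x. -/
open Complex Real Filter Topology

/-- The mean `∫ v in 0..1, exp (-iθv)`, that is `(1 - exp (-iθ)) / (iθ)` extended by `1` at `0`. -/
noncomputable def expMean (θ : ℝ) : ℂ := dslope (fun z : ℂ ↦ 1 - cexp (-z)) 0 (θ * I)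

theorem expMean_zero : expMean 0 = 1 := by
  have h : HasDerivAt (fun z : ℂ ↦ 1 - cexp (-z)) 1 0 := by
    simpa using ((hasDerivAt_neg (0 : ℂ)).cexp.const_sub 1)
  simp [expMean, h.deriv]

theorem expMean_mul (θ : ℝ) : expMean θ * (θ * I) = 1 - cexp (-(θ * I)) := by
  have := sub_smul_dslope (fun z : ℂ ↦ 1 - cexp (-z)) 0 (θ * I)
  simp only [smul_eq_mul, sub_zero, neg_zero, Complex.exp_zero, sub_self] at this
  rw [expMean, mul_comm, this]

theorem expMean_ne_zero {θ : ℝ} (hθ : |θ| < 2 * π) : expMean θ ≠ 0 := by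
  intro h0
  have h := expMean_mul θ
  rw [h0, zero_mul, eq_comm, sub_eq_zero, eq_comm, Complex.exp_eq_one_iff] at h
  obtain ⟨n, hn⟩ := h
  have hn' : -θ = n * (2 * π) := by simpa using congrArg Complex.im hn
  rw [← abs_neg, hn', abs_mul, abs_of_pos Real.two_pi_pos] at hθ
  have h1 : |(n : ℝ)| < 1 := by
    by_contra! hc
    nlinarith [Real.two_pi_pos]
  have h2 : n = 0 := Int.abs_lt_one_iff.mp (by exact_mod_cast h1)
  have h3 : θ = 0 := by simpa [h2] using hn'
  rw [h3, expMean_zero] at h0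
  exact one_ne_zero h0

/-- On a compact subinterval of `(-2π, 2π)` the function `1/(1 - exp (-iθ)) - 1/(iθ)`, extended
continuously at `0`, is bounded and Lipschitz. -/
theorem exists_one_sub_expMean_eq {a : ℝ} (ha : a < 2 * π) :
    ∃ (φ : ℝ → ℂ) (B L : ℝ), 0 ≤ B ∧ 0 ≤ L ∧
      (∀ θ, |θ| ≤ a → 1 - expMean θ = φ θ * (1 - cexp (-(θ * I)))) ∧
      (∀ θ, |θ| ≤ a → ‖φ θ‖ ≤ B) ∧
      ∀ θ θ', |θ| ≤ a → |θ'| ≤ a → ‖φ θ - φ θ'‖ ≤ L * |θ - θ'| := by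
  set E : ℂ → ℂ := dslope (fun z : ℂ ↦ 1 - cexp (-z)) 0 with hE
  set F : ℂ → ℂ := dslope E 0 with hF
  have hEd : Differentiable ℂ E := by
    rw [← differentiableOn_univ, hE, Complex.differentiableOn_dslope univ_mem]
    exact Differentiable.differentiableOn (by fun_prop)
  have hFd : Differentiable ℂ F := by
    rw [← differentiableOn_univ, hF, Complex.differentiableOn_dslope univ_mem]
    exact hEd.differentiableOn
  have hE1 : ContDiff ℝ 1 E := hEd.contDiff.restrict_scalars ℝ
  have hF1 : ContDiff ℝ 1 F := hFd.contDiff.restrict_scalars ℝ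
  have hγ : ContDiff ℝ 1 (fun θ : ℝ ↦ (θ : ℂ) * I) := ofRealCLM.contDiff.mul contDiff_const
  have hne : ∀ θ ∈ Set.Icc (-a) a, E (θ * I) ≠ 0 := fun θ hθ ↦
    expMean_ne_zero ((abs_le.mpr hθ).trans_lt ha)
  set φ : ℝ → ℂ := fun θ ↦ -(F (θ * I)) * (E (θ * I))⁻¹ with hφ
  have hsm : ContDiffOn ℝ 1 φ (Set.Icc (-a) a) := by
    exact (hF1.comp hγ).neg.contDiffOn.mul ((hE1.comp hγ).contDiffOn.inv hne)
  obtain ⟨B, hB⟩ := isCompact_Icc.exists_bound_of_continuousOn hsm.continuousOn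
  obtain ⟨L, hL⟩ := hsm.exists_lipschitzOnWith one_ne_zero (convex_Icc _ _) isCompact_Icc
  refine ⟨φ, max B 0, L, le_max_right _ _, L.2, fun θ hθ ↦ ?_, fun θ hθ ↦ ?_,
    fun θ θ' hθ hθ' ↦ ?_⟩
  · have h1 : θ * I * F (θ * I) = E (θ * I) - 1 := by
      have := sub_smul_dslope E 0 (θ * I)
      have h0 : E 0 = 1 := by
        rw [← expMean_zero, expMean, ofReal_zero, zero_mul]
      simpa [h0] using this
    have h2 := hne θ (abs_le.mp hθ)
    rw [← expMean_mul θ, hφ, show expMean θ = E (θ * I) from rfl]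
    field_simp
    linear_combination h1
  · exact (hB θ (abs_le.mp hθ)).trans (le_max_left _ _)
  · simpa [dist_eq_norm] using hL.dist_le_mul θ (abs_le.mp hθ) θ' (abs_le.mp hθ')

theorem exists_antideriv_exp (θ : ℝ) :
    ∃ P : ℝ → ℂ, P 0 = 0 ∧ P 1 = expMean θ ∧
      ∀ v, HasDerivAt P (cexp (-(θ * I) * (v : ℝ))) v := by
  rcases eq_or_ne θ 0 with rfl | hθ
  · exact ⟨fun v ↦ v, by simp, by simp [expMean_zero], fun v ↦ by
      simpa using (hasDerivAt_id (v : ℂ)).comp_ofReal⟩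
  · have hc : (θ : ℂ) * I ≠ 0 := by simp [hθ]
    refine ⟨fun v ↦ (1 - cexp (-(θ * I) * v)) / (θ * I), by simp, ?_, fun v ↦ ?_⟩
    · rw [div_eq_iff hc, expMean_mul]; simp
    · have h := ((((hasDerivAt_id (v : ℂ)).comp_ofReal.const_mul (-(θ * I))).cexp).const_sub
        1).div_const (θ * I)
      refine h.congr_deriv ?_
      simp only [id]
      field_simp
      simp [hθ]

theorem norm_mul_exp_sub_mul_exp_le (r r' x y : ℝ) (hr' : 0 ≤ r') :
    ‖(r : ℂ) * cexp (x * I) - r' * cexp (y * I)‖ ≤ |r - r'| + r' * |x - y| := by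
  have h1 : (r : ℂ) * cexp (x * I) - r' * cexp (y * I) =
      ((r - r' : ℝ) : ℂ) * cexp (x * I) +
        r' * (cexp (y * I) * (cexp (I * (x - y : ℝ)) - 1)) := by
    have : cexp (x * I) = cexp (y * I) * cexp (I * (x - y : ℝ)) := by
      rw [← Complex.exp_add]; congr 1; push_cast; ring
    rw [mul_sub, ← this]; push_cast; ring
  rw [h1]
  refine (norm_add_le _ _).trans (add_le_add ?_ ?_)
  · rw [norm_mul, Complex.norm_exp_ofReal_mul_I, mul_one, Complex.norm_real, Real.norm_eq_abs]
  · rw [norm_mul, norm_mul, Complex.norm_exp_ofReal_mul_I, one_mul, Complex.norm_real,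
      Real.norm_of_nonneg hr']
    exact mul_le_mul_of_nonneg_left norm_exp_I_mul_ofReal_sub_one_le hr'

theorem ofReal_cpow_neg_eq {u : ℝ} (hu : 0 < u) (s : ℂ) :
    (u : ℂ) ^ (-s) = (u ^ (-s.re) : ℝ) * cexp ((-s.im * Real.log u : ℝ) * I) := by
  rw [Complex.cpow_def_of_ne_zero (by exact_mod_cast hu.ne'), Real.rpow_def_of_pos hu,
    Complex.ofReal_exp, ← Complex.exp_add, ← Complex.ofReal_log hu.le]
  congr 1
  apply Complex.ext <;> simp [mul_comm]

theorem abs_log_sub_log_sub_le {a v : ℝ} (ha : 0 < a) (hv : v ∈ Set.Icc (0 : ℝ) 1) :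
    |Real.log (a + v) - Real.log a - v / a| ≤ 1 / a ^ 2 := by
  have hv0 := hv.1
  have hv1 := hv.2
  have hq : 0 < (a + v) / a := by positivity
  rw [← Real.log_div (by positivity) ha.ne']
  have h1 := Real.log_le_sub_one_of_pos hq
  have h2 := Real.one_sub_inv_le_log_of_pos hq
  have e1 : (a + v) / a - 1 = v / a := by field_simp; ring
  have e2 : 1 - ((a + v) / a)⁻¹ - v / a = -(v ^ 2 / (a * (a + v))) := by field_simp; ring
  have e3 : v ^ 2 / (a * (a + v)) ≤ 1 / a ^ 2 := by
    apply div_le_div₀ zero_le_one (by nlinarith) (by positivity) (by nlinarith)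
  rw [abs_le]
  constructor
  · linarith
  · have : 0 < 1 / a ^ 2 := by positivity
    linarith

theorem norm_cpow_sub_cpow_mul_exp_le {a v : ℝ} (ha : 0 < a) (hv : v ∈ Set.Icc (0 : ℝ) 1)
    {s : ℂ} (hs : 0 < s.re) :
    ‖((a + v : ℝ) : ℂ) ^ (-s) - (a : ℂ) ^ (-s) * cexp (-((s.im / a : ℝ) * I) * v)‖ ≤
      (a ^ (-s.re) - (a + 1) ^ (-s.re)) + a ^ (-s.re) * (|s.im| / a ^ 2) := by
  have hv0 := hv.1
  have hav : 0 < a + v := by linarith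
  have e : (a : ℂ) ^ (-s) * cexp (-((s.im / a : ℝ) * I) * v) =
      (a ^ (-s.re) : ℝ) * cexp ((-s.im * (Real.log a + v / a) : ℝ) * I) := by
    rw [ofReal_cpow_neg_eq ha, mul_assoc, ← Complex.exp_add]
    congr 2
    push_cast
    ring
  rw [e, ofReal_cpow_neg_eq hav]
  refine (norm_mul_exp_sub_mul_exp_le _ _ _ _ (by positivity)).trans (add_le_add ?_ ?_)
  · have h1 : (a + v) ^ (-s.re) ≤ a ^ (-s.re) :=
      Real.rpow_le_rpow_of_nonpos ha (by linarith) (by linarith)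
    have h2 : (a + 1) ^ (-s.re) ≤ (a + v) ^ (-s.re) :=
      Real.rpow_le_rpow_of_nonpos hav (by linarith [hv.2]) (by linarith)
    rw [abs_sub_comm, abs_of_nonneg (by linarith)]
    linarith
  · refine mul_le_mul_of_nonneg_left ?_ (by positivity)
    rw [show -s.im * Real.log (a + v) - -s.im * (Real.log a + v / a) =
      -s.im * (Real.log (a + v) - Real.log a - v / a) by ring, abs_mul, abs_neg,
      div_eq_mul_one_div |s.im|]
    exact mul_le_mul_of_nonneg_left (abs_log_sub_log_sub_le ha hv) (abs_nonneg _)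

theorem hasDerivAt_ofReal_add_cpow_s13 {a v : ℝ} (h : 0 < a + v) (r : ℂ) :
    HasDerivAt (fun v : ℝ ↦ ((a + v : ℝ) : ℂ) ^ r) (r * ((a + v : ℝ) : ℂ) ^ (r - 1)) v := by
  have h1 : HasDerivAt (fun z : ℂ ↦ ((a : ℂ) + z) ^ r)
      (r * ((a : ℂ) + (v : ℝ)) ^ (r - 1) * 1) (v : ℝ) :=
    ((hasDerivAt_id ((v : ℝ) : ℂ)).const_add (a : ℂ)).cpow_const
      (by rw [id, ← ofReal_add]; exact ofReal_mem_slitPlane.mpr h)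
  simpa using h1.comp_ofReal

theorem hasDerivAt_ofReal_add_cpow_div {a v : ℝ} (h : 0 < a + v) {s : ℂ} (hs : s ≠ 1) :
    HasDerivAt (fun v : ℝ ↦ ((a + v : ℝ) : ℂ) ^ (1 - s) / (1 - s))
      (((a + v : ℝ) : ℂ) ^ (-s)) v := by
  have hs' : 1 - s ≠ 0 := sub_ne_zero.mpr hs.symm
  refine ((hasDerivAt_ofReal_add_cpow_s13 h (1 - s)).div_const (1 - s)).congr_deriv ?_
  rw [show 1 - s - 1 = -s by ring]
  field_simp

theorem norm_integral_cpow_sub_expMean_le {a : ℝ} (ha : 0 < a) {s : ℂ} (hs : 0 < s.re)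
    (hs1 : s ≠ 1) :
    ‖(((a + 1 : ℝ) : ℂ) ^ (1 - s) / (1 - s) - (a : ℂ) ^ (1 - s) / (1 - s)) -
        (a : ℂ) ^ (-s) * expMean (s.im / a)‖ ≤
      (a ^ (-s.re) - (a + 1) ^ (-s.re)) + a ^ (-s.re) * (|s.im| / a ^ 2) := by
  obtain ⟨P, hP0, hP1, hP⟩ := exists_antideriv_exp (s.im / a)
  have h := norm_image_sub_le_of_norm_deriv_le_segment_01'
    (f := fun v : ℝ ↦ ((a + v : ℝ) : ℂ) ^ (1 - s) / (1 - s) - (a : ℂ) ^ (-s) * P v)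
    (fun v hv ↦ ((hasDerivAt_ofReal_add_cpow_div (by linarith [hv.1]) hs1).sub
      ((hP v).const_mul _)).hasDerivWithinAt)
    (fun v hv ↦ norm_cpow_sub_cpow_mul_exp_le ha ⟨hv.1, hv.2.le⟩ hs)
  refine (congrArg norm ?_).trans_le h
  simp only [hP0, hP1, add_zero]
  ring

theorem norm_cpow_sub_integral_sub_le {a : ℝ} {s : ℂ} {φ : ℝ → ℂ} {b B L : ℝ} (hB : 0 ≤ B)
    (hφ : ∀ θ, |θ| ≤ b → 1 - expMean θ = φ θ * (1 - cexp (-(θ * I))))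
    (hφB : ∀ θ, |θ| ≤ b → ‖φ θ‖ ≤ B)
    (hφL : ∀ θ θ', |θ| ≤ b → |θ'| ≤ b → ‖φ θ - φ θ'‖ ≤ L * |θ - θ'|)
    (ha : 0 < a) (hs : 0 < s.re) (hs1 : s ≠ 1) (hab : |s.im| ≤ b * a) :
    ‖((a : ℂ) ^ (-s) - (((a + 1 : ℝ) : ℂ) ^ (1 - s) / (1 - s) - (a : ℂ) ^ (1 - s) / (1 - s))) -
        (φ (s.im / a) * (a : ℂ) ^ (-s) - φ (s.im / (a + 1)) * ((a + 1 : ℝ) : ℂ) ^ (-s))‖ ≤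
      (1 + B) * ((a ^ (-s.re) - (a + 1) ^ (-s.re)) + a ^ (-s.re) * (|s.im| / a ^ 2)) +
        L * (|s.im| * (1 / a - 1 / (a + 1))) * a ^ (-s.re) := by
  have ha1 : 0 < a + 1 := by linarith
  have hb : 0 ≤ b := by
    by_contra! hb
    nlinarith [abs_nonneg s.im]
  have hθ : |s.im / a| ≤ b := by rwa [abs_div, abs_of_pos ha, div_le_iff₀ ha]
  have hθ' : |s.im / (a + 1)| ≤ b := by
    rw [abs_div, abs_of_pos ha1, div_le_iff₀ ha1]; nlinarith
  have h1 := norm_integral_cpow_sub_expMean_le ha hs hs1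
  have h2 := norm_cpow_sub_cpow_mul_exp_le ha (v := 1) ⟨zero_le_one, le_rfl⟩ hs
  have h3 := hφL _ _ hθ' hθ
  have h4 := hφB _ hθ
  have h5 := hφ _ hθ
  simp only [ofReal_one, mul_one] at h2
  set Q := (a ^ (-s.re) - (a + 1) ^ (-s.re)) + a ^ (-s.re) * (|s.im| / a ^ 2)
  set J := ((a + 1 : ℝ) : ℂ) ^ (1 - s) / (1 - s) - (a : ℂ) ^ (1 - s) / (1 - s)
  set p := (a : ℂ) ^ (-s)
  set q := ((a + 1 : ℝ) : ℂ) ^ (-s) with hq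
  set e := cexp (-((s.im / a : ℝ) * I))
  have hqn : ‖q‖ ≤ a ^ (-s.re) := by
    rw [hq, Complex.norm_cpow_eq_rpow_re_of_pos ha1, neg_re]
    exact Real.rpow_le_rpow_of_nonpos ha (by linarith) (by linarith)
  have key : p - J - (φ (s.im / a) * p - φ (s.im / (a + 1)) * q) =
      -(J - p * expMean (s.im / a)) + φ (s.im / a) * (q - p * e) +
        (φ (s.im / (a + 1)) - φ (s.im / a)) * q := by
    linear_combination p * h5
  have h6 : |s.im / (a + 1) - s.im / a| = |s.im| * (1 / a - 1 / (a + 1)) := by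
    have : 0 ≤ 1 / a - 1 / (a + 1) :=
      sub_nonneg.mpr (one_div_le_one_div_of_le ha (by linarith))
    rw [abs_sub_comm, show s.im / a - s.im / (a + 1) = s.im * (1 / a - 1 / (a + 1)) by ring,
      abs_mul, abs_of_nonneg this]
  rw [h6] at h3
  rw [key, one_add_mul]
  refine (norm_add₃_le).trans (add_le_add (add_le_add ?_ ?_) ?_)
  · rwa [norm_neg]
  · rw [norm_mul]
    exact mul_le_mul h4 h2 (norm_nonneg _) hB
  · rw [norm_mul]
    exact mul_le_mul h3 hqn (norm_nonneg _) ((norm_nonneg _).trans h3)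

theorem norm_sub_one_mul_cpow_sub_le {a δ : ℝ} (ha : 1 ≤ a) {w : ℂ} (hδ : 0 ≤ δ) (hw : δ ≤ w.re) :
    ‖(w - 1) * (a : ℂ) ^ (-w) - ((a : ℂ) ^ (1 - w) - ((a + 1 : ℝ) : ℂ) ^ (1 - w))‖ ≤
      ‖w - 1‖ * (‖w‖ * a ^ (-(δ + 1))) := by
  have h1 : ∀ v ∈ Set.Icc (0 : ℝ) 1,
      ‖((a + v : ℝ) : ℂ) ^ (-w) - (a : ℂ) ^ (-w)‖ ≤ ‖w‖ * a ^ (-(δ + 1)) := by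
    intro v hv
    have h := norm_image_sub_le_of_norm_deriv_le_segment' (a := 0) (b := 1)
      (C := ‖w‖ * a ^ (-(δ + 1)))
      (f := fun v : ℝ ↦ ((a + v : ℝ) : ℂ) ^ (-w))
      (fun v hv ↦ (hasDerivAt_ofReal_add_cpow_s13 (by linarith [hv.1]) (-w)).hasDerivWithinAt)
      (fun v hv ↦ by
        have hav : a ≤ a + v := by linarith [hv.1]
        rw [norm_mul, norm_neg, Complex.norm_cpow_eq_rpow_re_of_pos (by linarith)]
        refine mul_le_mul_of_nonneg_left ?_ (norm_nonneg _)
        calc (a + v) ^ (-w - 1).re ≤ (a + v) ^ (-(δ + 1)) := by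
              apply Real.rpow_le_rpow_of_exponent_le (by linarith)
              simp; linarith
          _ ≤ a ^ (-(δ + 1)) :=
              Real.rpow_le_rpow_of_nonpos (by linarith) hav (by linarith)) v hv
    rw [add_zero] at h
    refine h.trans (mul_le_of_le_one_right (by positivity) (by linarith [hv.2]))
  have h := norm_image_sub_le_of_norm_deriv_le_segment_01'
    (f := fun v : ℝ ↦ ((a + v : ℝ) : ℂ) ^ (1 - w) + ((w - 1) * (a : ℂ) ^ (-w)) * v)
    (C := ‖w - 1‖ * (‖w‖ * a ^ (-(δ + 1))))
    (fun v hv ↦ ((hasDerivAt_ofReal_add_cpow_s13 (by linarith [hv.1]) (1 - w)).add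
      ((hasDerivAt_id (v : ℂ)).comp_ofReal.const_mul _)).hasDerivWithinAt)
    (fun v hv ↦ by
      rw [show 1 - w - 1 = -w by ring, show (1 - w) * ((a + v : ℝ) : ℂ) ^ (-w) +
        (w - 1) * (a : ℂ) ^ (-w) * 1 = -((w - 1) * (((a + v : ℝ) : ℂ) ^ (-w) - (a : ℂ) ^ (-w)))
        by ring, norm_neg, norm_mul]
      exact mul_le_mul_of_nonneg_left (h1 v ⟨hv.1, hv.2.le⟩) (norm_nonneg _))
  refine (congrArg norm ?_).trans_le h
  simp
  ring

/-- The partial sum `∑_{n ≤ N} n^(-s)` corrected by the main term `(N+1)^(1-s)/(1-s)`. -/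
noncomputable def correctedPartialSum (s : ℂ) (N : ℕ) : ℂ :=
  ∑ j ∈ Finset.range N, (((j : ℝ) + 1 : ℝ) : ℂ) ^ (-s) -
    (((N : ℝ) + 1 : ℝ) : ℂ) ^ (1 - s) / (1 - s)

/-- The increments of `(s - 1)` times `correctedPartialSum s`. -/
noncomputable def zetaIncrement (j : ℕ) (s : ℂ) : ℂ :=
  (s - 1) * (((j : ℝ) + 1 : ℝ) : ℂ) ^ (-s) -
    ((((j : ℝ) + 1 : ℝ) : ℂ) ^ (1 - s) - (((j : ℝ) + 1 + 1 : ℝ) : ℂ) ^ (1 - s))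

theorem sum_zetaIncrement (s : ℂ) (N : ℕ) :
    1 + ∑ j ∈ Finset.range N, zetaIncrement j s =
      (s - 1) * ∑ j ∈ Finset.range N, (((j : ℝ) + 1 : ℝ) : ℂ) ^ (-s) +
        (((N : ℝ) + 1 : ℝ) : ℂ) ^ (1 - s) := by
  induction N with
  | zero => simp
  | succ N ih =>
    rw [Finset.sum_range_succ, ← add_assoc, ih, Finset.sum_range_succ, zetaIncrement]
    push_cast
    ring

theorem sum_zetaIncrement_eq {s : ℂ} (hs : s ≠ 1) (N : ℕ) :
    1 + ∑ j ∈ Finset.range N, zetaIncrement j s = (s - 1) * correctedPartialSum s N := by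
  have hs' : 1 - s ≠ 0 := sub_ne_zero.mpr hs.symm
  rw [sum_zetaIncrement, correctedPartialSum]
  field_simp
  ring

theorem differentiable_zetaIncrement (j : ℕ) : Differentiable ℂ (zetaIncrement j) := by
  have h1 : (((j : ℝ) + 1 : ℝ) : ℂ) ≠ 0 := ofReal_ne_zero.mpr (by positivity)
  have h2 : (((j : ℝ) + 1 + 1 : ℝ) : ℂ) ≠ 0 := ofReal_ne_zero.mpr (by positivity)
  have e1 : Differentiable ℂ fun s : ℂ ↦ (((j : ℝ) + 1 : ℝ) : ℂ) ^ (-s) := fun s ↦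
    (differentiable_neg s).const_cpow (Or.inl h1)
  have e2 : Differentiable ℂ fun s : ℂ ↦ (((j : ℝ) + 1 : ℝ) : ℂ) ^ (1 - s) := fun s ↦
    (differentiableAt_id.const_sub 1).const_cpow (Or.inl h1)
  have e3 : Differentiable ℂ fun s : ℂ ↦ (((j : ℝ) + 1 + 1 : ℝ) : ℂ) ^ (1 - s) := fun s ↦
    (differentiableAt_id.const_sub 1).const_cpow (Or.inl h2)
  exact ((differentiable_id.sub_const 1).mul e1).sub (e2.sub e3)

theorem summable_nat_add_one_rpow_neg {δ : ℝ} (hδ : 0 < δ) :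
    Summable fun j : ℕ ↦ ((j : ℝ) + 1) ^ (-(δ + 1)) := by
  have h := (Real.summable_nat_rpow (p := -(δ + 1))).mpr (by linarith)
  simpa using (summable_nat_add_iff 1).mpr h

theorem norm_zetaIncrement_le {δ R : ℝ} (hδ : 0 ≤ δ) {w : ℂ} (hw : δ ≤ w.re) (hR : ‖w‖ ≤ R)
    (j : ℕ) : ‖zetaIncrement j w‖ ≤ (R + 1) * R * ((j : ℝ) + 1) ^ (-(δ + 1)) := by
  have hj : (1 : ℝ) ≤ j + 1 := by linarith [j.cast_nonneg (α := ℝ)]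
  refine (norm_sub_one_mul_cpow_sub_le hj hδ hw).trans ?_
  have h1 : ‖w - 1‖ ≤ R + 1 := (norm_sub_le _ _).trans (by simpa using hR)
  have h2 : 0 ≤ R := (norm_nonneg w).trans hR
  rw [← mul_assoc]
  gcongr

theorem summable_zetaIncrement {s : ℂ} (hs : 0 < s.re) :
    Summable fun j ↦ zetaIncrement j s :=
  .of_norm_bounded ((summable_nat_add_one_rpow_neg hs).mul_left _)
    (norm_zetaIncrement_le hs.le le_rfl le_rfl)

theorem one_add_tsum_zetaIncrement_of_one_lt {s : ℂ} (hs : 1 < s.re) :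
    1 + ∑' j, zetaIncrement j s = riemannZeta₁ s := by
  have hs1 : s ≠ 1 := by rintro rfl; simp at hs
  have h1 := ((summable_zetaIncrement (zero_lt_one.trans hs)).hasSum.tendsto_sum_nat).const_add 1
  refine tendsto_nhds_unique h1 ?_
  simp_rw [sum_zetaIncrement]
  have h2 : HasSum (fun j : ℕ ↦ (((j : ℝ) + 1 : ℝ) : ℂ) ^ (-s)) (riemannZeta s) := by
    rw [zeta_eq_tsum_one_div_nat_add_one_cpow hs]
    have : Summable fun j : ℕ ↦ 1 / ((j : ℂ) + 1) ^ s := by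
      simpa using (summable_nat_add_iff 1).mpr (Complex.summable_one_div_nat_cpow.mpr hs)
    convert this.hasSum using 2 with j
    rw [Complex.cpow_neg, one_div]
    push_cast
    rfl
  have h3 : Tendsto (fun N : ℕ ↦ (((N : ℝ) + 1 : ℝ) : ℂ) ^ (1 - s)) atTop (𝓝 0) := by
    rw [tendsto_zero_iff_norm_tendsto_zero]
    have h4 : Tendsto (fun N : ℕ ↦ (N : ℝ) + 1) atTop atTop :=
      tendsto_atTop_add_const_right _ _ tendsto_natCast_atTop_atTop
    refine ((tendsto_rpow_neg_atTop (sub_pos.mpr hs)).comp h4).congr fun N ↦ ?_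
    rw [Complex.norm_cpow_eq_rpow_re_of_pos (by positivity)]
    simp
  have h5 := (h2.tendsto_sum_nat.const_mul (s - 1)).add h3
  rw [add_zero] at h5
  rwa [riemannZeta_eq_inv_sub_mul hs1, mul_inv_cancel_left₀ (sub_ne_zero.mpr hs1)] at h5

theorem one_add_tsum_zetaIncrement {s : ℂ} (hs : 0 < s.re) :
    1 + ∑' j, zetaIncrement j s = riemannZeta₁ s := by
  set δ : ℝ := min (s.re / 2) 1
  set R : ℝ := ‖s‖ + 3
  have hδ : 0 < δ := lt_min (by linarith) one_pos
  set U : Set ℂ := {w : ℂ | δ < w.re} ∩ Metric.ball 0 R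
  have hUo : IsOpen U := (isOpen_lt continuous_const Complex.continuous_re).inter Metric.isOpen_ball
  have hUc : Convex ℝ U := (convex_halfSpace_re_gt δ).inter (convex_ball _ _)
  have hsU : s ∈ U := ⟨(min_le_left _ _).trans_lt (half_lt_self hs), by simp [R]⟩
  have h2U : (2 : ℂ) ∈ U :=
    ⟨(min_le_right _ _).trans_lt (show (1 : ℝ) < (2 : ℂ).re by simp), by
      simp only [Metric.mem_ball, dist_zero_right, Complex.norm_ofNat, R]
      linarith [norm_nonneg s]⟩
  have hd : DifferentiableOn ℂ (fun w ↦ 1 + ∑' j, zetaIncrement j w) U :=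
    (Complex.differentiableOn_tsum_of_summable_norm
      ((summable_nat_add_one_rpow_neg hδ).mul_left ((R + 1) * R))
      (fun j ↦ (differentiable_zetaIncrement j).differentiableOn) hUo
      (fun j w hw ↦ norm_zetaIncrement_le hδ.le hw.1.le
        (mem_ball_zero_iff.mp hw.2).le j)).const_add 1
  refine (hd.analyticOnNhd hUo).eqOn_of_preconnected_of_eventuallyEq
    (differentiable_riemannZeta₁.differentiableOn.analyticOnNhd hUo) hUc.isPreconnected h2U ?_ hsU
  filter_upwards [(isOpen_lt continuous_const Complex.continuous_re).mem_nhds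
    (show (1 : ℝ) < (2 : ℂ).re by simp)] with w hw
  exact one_add_tsum_zetaIncrement_of_one_lt hw

theorem tendsto_correctedPartialSum {s : ℂ} (hs : 0 < s.re) (hs1 : s ≠ 1) :
    Tendsto (correctedPartialSum s) atTop (𝓝 (riemannZeta s)) := by
  have hs' : s - 1 ≠ 0 := sub_ne_zero.mpr hs1
  have h := (((summable_zetaIncrement hs).hasSum.tendsto_sum_nat).const_add 1).const_mul (s - 1)⁻¹
  rw [one_add_tsum_zetaIncrement hs, ← riemannZeta_eq_inv_sub_mul hs1] at h
  refine h.congr fun N ↦ ?_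
  rw [sum_zetaIncrement_eq hs1, inv_mul_cancel_left₀ hs']

theorem exists_norm_correctedPartialSum_sub_le {b : ℝ} (hb0 : 0 ≤ b) (hb : b < 2 * π) :
    ∃ K : ℝ, 0 ≤ K ∧ ∀ s : ℂ, 0 < s.re → s ≠ 1 → ∀ m : ℕ, |s.im| ≤ b * (m + 1) → ∀ n : ℕ,
      ‖correctedPartialSum s (m + n) - correctedPartialSum s m‖ ≤
        K * ((m : ℝ) + 1) ^ (-s.re) := by
  obtain ⟨φ, B, L, hB, hL, hφ, hφB, hφL⟩ := exists_one_sub_expMean_eq hb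
  set K₁ : ℝ := (1 + B) * (2 * b) + L * b
  refine ⟨2 * B + ((1 + B) + K₁), by positivity, fun s hs hs1 m hm n ↦ ?_⟩
  set M : ℝ := (m : ℝ) + 1
  have hM : 1 ≤ M := by simp [M]
  have hMp : 0 < M := by linarith
  set c : ℝ := M ^ (-s.re)
  have hc : 0 < c := by positivity
  set S : ℕ → ℂ := fun k ↦ φ (s.im / (M + k)) * ((M + k : ℝ) : ℂ) ^ (-s)
  set G : ℕ → ℝ := fun k ↦ (1 + B) * (M + k) ^ (-s.re) + K₁ * c * (M / (M + k))
  have hle : ∀ k : ℕ, (M + k : ℝ) ^ (-s.re) ≤ c := fun k ↦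
    Real.rpow_le_rpow_of_nonpos hMp (by linarith [k.cast_nonneg (α := ℝ)]) (by linarith)
  have hS : ∀ k, ‖S k‖ ≤ B * c := by
    intro k
    have hk : 0 < M + k := by positivity
    rw [norm_mul, Complex.norm_cpow_eq_rpow_re_of_pos hk, neg_re]
    refine mul_le_mul (hφB _ ?_) (hle k) (by positivity) hB
    rw [abs_div, abs_of_pos hk, div_le_iff₀ hk]
    nlinarith [k.cast_nonneg (α := ℝ)]
  have hstep : ∀ k, ‖(correctedPartialSum s (m + (k + 1)) + S (k + 1)) -
      (correctedPartialSum s (m + k) + S k)‖ ≤ G k - G (k + 1) := by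
    intro k
    have hk0 : (0 : ℝ) ≤ k := k.cast_nonneg
    have hk : 0 < M + k := by positivity
    have h := norm_cpow_sub_integral_sub_le hB hφ hφB hφL hk hs hs1
      (hm.trans (by nlinarith))
    have e1 : (correctedPartialSum s (m + (k + 1)) + S (k + 1)) -
        (correctedPartialSum s (m + k) + S k) =
      ((M + k : ℝ) : ℂ) ^ (-s) - (((M + k + 1 : ℝ) : ℂ) ^ (1 - s) / (1 - s) -
          ((M + k : ℝ) : ℂ) ^ (1 - s) / (1 - s)) -
        (φ (s.im / (M + k)) * ((M + k : ℝ) : ℂ) ^ (-s) -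
          φ (s.im / (M + k + 1)) * ((M + k + 1 : ℝ) : ℂ) ^ (-s)) := by
      have c1 : ((m + k : ℕ) : ℝ) + 1 = M + k := by simp only [M]; push_cast; ring
      have c2 : ((m + (k + 1) : ℕ) : ℝ) + 1 = M + k + 1 := by simp only [M]; push_cast; ring
      have c3 : M + ((k + 1 : ℕ) : ℝ) = M + k + 1 := by push_cast; ring
      simp only [correctedPartialSum, S, c1, c3, ← add_assoc m k 1, Finset.sum_range_succ]
      rw [add_assoc m k 1, c2]
      ring
    rw [e1]
    refine h.trans ?_
    set a : ℝ := M + k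
    have ha1 : 1 ≤ a := by linarith
    have hd : 0 ≤ 1 / a - 1 / (a + 1) :=
      sub_nonneg.mpr (one_div_le_one_div_of_le hk (by linarith))
    have f1 : 1 / a ^ 2 ≤ 2 * (1 / a - 1 / (a + 1)) := by
      rw [show 2 * (1 / a - 1 / (a + 1)) = 2 / (a * (a + 1)) by field_simp; ring]
      rw [div_le_div_iff₀ (by positivity) (by positivity)]
      nlinarith
    have f2 : |s.im| / a ^ 2 ≤ b * M * (2 * (1 / a - 1 / (a + 1))) := by
      rw [div_eq_mul_one_div]
      exact mul_le_mul hm f1 (by positivity) (by positivity)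
    have f3 : a ^ (-s.re) * (|s.im| / a ^ 2) ≤ c * (b * M * (2 * (1 / a - 1 / (a + 1)))) :=
      mul_le_mul (hle k) f2 (by positivity) hc.le
    have f4 : L * (|s.im| * (1 / a - 1 / (a + 1))) * a ^ (-s.re) ≤
        L * (b * M * (1 / a - 1 / (a + 1))) * c := by
      have := hle k
      gcongr
    have e2 : G k - G (k + 1) = (1 + B) * (a ^ (-s.re) - (a + 1) ^ (-s.re)) +
        K₁ * c * (M * (1 / a - 1 / (a + 1))) := by
      simp only [G, Nat.cast_add, Nat.cast_one, ← add_assoc]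
      ring
    have f5 := mul_le_mul_of_nonneg_left f3 (show 0 ≤ 1 + B by linarith)
    rw [e2]
    simp only [K₁]
    linarith
  have hsum : ∀ k, ‖(correctedPartialSum s (m + k) + S k) - (correctedPartialSum s m + S 0)‖ ≤
      G 0 - G k := by
    intro k
    induction k with
    | zero => simp
    | succ k ih =>
      have := norm_add_le _ _ |>.trans (add_le_add (hstep k) ih)
      rw [sub_add_sub_cancel] at this
      linarith
  have hG0 : G 0 = (1 + B) * c + K₁ * c := by
    simp only [G, Nat.cast_zero, add_zero, div_self hMp.ne', mul_one, c]
  have hGn : 0 ≤ G n := by positivity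
  have e3 : correctedPartialSum s (m + n) - correctedPartialSum s m =
      ((correctedPartialSum s (m + n) + S n) - (correctedPartialSum s m + S 0)) + S 0 - S n := by
    ring
  rw [e3]
  have := (norm_sub_le _ _).trans (add_le_add_left (norm_add_le
    ((correctedPartialSum s (m + n) + S n) - (correctedPartialSum s m + S 0)) (S 0)) ‖S n‖)
  linarith [hsum n, hS 0, hS n]

theorem norm_cpow_div_sub_cpow_div_le {x y : ℝ} (hx : 0 < x) (hxy : x ≤ y) (hyx : y ≤ x + 1)
    {s : ℂ} (hs : 0 < s.re) (hs1 : s ≠ 1) :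
    ‖(y : ℂ) ^ (1 - s) / (1 - s) - (x : ℂ) ^ (1 - s) / (1 - s)‖ ≤ x ^ (-s.re) := by
  have h := norm_image_sub_le_of_norm_deriv_le_segment' (a := 0) (b := y - x)
    (C := x ^ (-s.re)) (f := fun v : ℝ ↦ ((x + v : ℝ) : ℂ) ^ (1 - s) / (1 - s))
    (fun v hv ↦ (hasDerivAt_ofReal_add_cpow_div (by linarith [hv.1]) hs1).hasDerivWithinAt)
    (fun v hv ↦ by
      rw [Complex.norm_cpow_eq_rpow_re_of_pos (by linarith [hv.1]), neg_re]
      exact Real.rpow_le_rpow_of_nonpos hx (by linarith [hv.1]) (by linarith))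
    (y - x) ⟨by linarith, le_rfl⟩
  rw [add_zero, add_sub_cancel, sub_zero] at h
  exact h.trans (mul_le_of_le_one_right (by positivity) (by linarith))

theorem sum_Icc_one_div_cpow (s : ℂ) (m : ℕ) :
    ∑ n ∈ Finset.Icc 1 m, 1 / (n : ℂ) ^ s =
      ∑ j ∈ Finset.range m, (((j : ℝ) + 1 : ℝ) : ℂ) ^ (-s) := by
  induction m with
  | zero => simp
  | succ m ih =>
    rw [Finset.sum_Icc_succ_top (by lia), ih, Finset.sum_range_succ, Complex.cpow_neg, one_div]
    push_cast
    rfl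

/-- For every real `C > 1` there is a constant `K > 0` such that for all `s = σ + it`
with `σ > 0`, `s ≠ 1`, and all real `x ≥ 1` with `|t| ≤ 2πx/C`,
`|ζ(s) - (∑_{n ≤ x} n^(-s) - x^(1-s)/(1-s))| ≤ K · x^(-σ)`. -/
theorem zeta_partial_sum_error_bound (C : ℝ) (hC : 1 < C) :
    ∃ K : ℝ, 0 < K ∧
      ∀ s : ℂ, 0 < s.re → s ≠ 1 →
        ∀ x : ℝ, 1 ≤ x → |s.im| ≤ 2 * π * x / C →
          ‖riemannZeta s -
              ((∑ n ∈ Finset.Icc 1 ⌊x⌋₊, 1 / (n : ℂ) ^ s) - (x : ℂ) ^ (1 - s) / (1 - s))‖ ≤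
            K * x ^ (-s.re) := by
  have hC0 : 0 < C := by linarith
  obtain ⟨K, hK, hbound⟩ := exists_norm_correctedPartialSum_sub_le (b := 2 * π / C)
    (by positivity) (div_lt_self Real.two_pi_pos hC)
  refine ⟨K + 1, by linarith, fun s hs hs1 x hx ht ↦ ?_⟩
  have hx0 : 0 < x := by linarith
  set m := ⌊x⌋₊
  have hm : x < m + 1 := Nat.lt_floor_add_one x
  have hm' : (m : ℝ) ≤ x := Nat.floor_le hx0.le
  have ht' : |s.im| ≤ 2 * π / C * (m + 1) := by
    refine ht.trans ?_
    rw [mul_div_right_comm]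
    gcongr
  have h1 : ‖riemannZeta s - correctedPartialSum s m‖ ≤ K * x ^ (-s.re) := by
    have hlim : Tendsto (fun n ↦ correctedPartialSum s (m + n)) atTop (𝓝 (riemannZeta s)) := by
      simpa only [add_comm m] using
        (tendsto_add_atTop_iff_nat m).mpr (tendsto_correctedPartialSum hs hs1)
    refine (le_of_tendsto (hlim.sub_const _).norm
      (Eventually.of_forall (hbound s hs hs1 m ht'))).trans ?_
    gcongr ?_ * ?_
    exact Real.rpow_le_rpow_of_nonpos hx0 hm.le (by linarith)
  have h2 := norm_cpow_div_sub_cpow_div_le hx0 hm.le (by linarith) hs hs1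
  have e : riemannZeta s -
      ((∑ n ∈ Finset.Icc 1 m, 1 / (n : ℂ) ^ s) - (x : ℂ) ^ (1 - s) / (1 - s)) =
      (riemannZeta s - correctedPartialSum s m) -
        ((((m : ℝ) + 1 : ℝ) : ℂ) ^ (1 - s) / (1 - s) - (x : ℂ) ^ (1 - s) / (1 - s)) := by
    rw [sum_Icc_one_div_cpow, correctedPartialSum]
    ring
  rw [e, add_one_mul]
  exact (norm_sub_le _ _).trans (add_le_add h1 h2)
end
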